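/- Let τ, C, C', β₁ > 0, let F ∈ S(τ,β₁,C,C') and let X₁,…,Xₙ be i.i.d. with distribution F. There exists a constant D₁, depending only on β₁, on a lower bound on τ and on an upper bound on C and C', such that for every integer k with 1 ≤ k ≤ ⌊log( n^{1/(τ(2β₁+1))} )⌋, E[ sup_{x ∈ [e^k, e^{k+1})} |p̂_x − p_x| ] ≤ D₁·√( e^{−kτ}/n ). -/

import Mathlib

open MeasureTheory Filter Set Asymptotics

noncomputable section

/-- The CDF of a measure on `ℝ`. -/
def cdfR (μ : Measure ℝ) (x : ℝ) : ℝ := (μ (Iic x)).toReal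

/-- The second order Pareto class `S(τ, β, C, C')`: càdlàg distribution functions on `[0,∞)`
(here encoded via their laws, probability measures giving no mass to `(-∞,0)`) such that
`|1 - F(x) - C·x^(-τ)| ≤ C'·x^(-τ(β+1))` whenever `F(x) ∈ (0,1]`. -/
def SOP (τ β C C' : ℝ) : Set (Measure ℝ) :=
  {μ | IsProbabilityMeasure μ ∧ μ (Iio 0) = 0 ∧
    ∀ x : ℝ, cdfR μ x ∈ Ioc (0 : ℝ) 1 →
      |1 - cdfR μ x - C * x ^ (-τ)| ≤ C' * x ^ (-(τ * (β + 1)))}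

/-- Joint law of `n` i.i.d. observations with common law `μ`. -/
def iidP (μ : Measure ℝ) (n : ℕ) : Measure (Fin n → ℝ) := Measure.pi fun _ => μ

/-- The empirical tail probability `p̂_x = n⁻¹ Σ_i 1{X_i > x}`. -/
def empTail (n : ℕ) (ω : Fin n → ℝ) (x : ℝ) : ℝ :=
  ((Finset.univ.filter fun i => x < ω i).card : ℝ) / n

/-- `sup_{x ∈ [e^k, e^{k+1})} |p̂_x - p_x|`. -/
def supDev (μ : Measure ℝ) (n k : ℕ) (ω : Fin n → ℝ) : ℝ :=
  ⨆ x : Ico (Real.exp (k : ℝ)) (Real.exp ((k : ℝ) + 1)),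
    |empTail n ω (x : ℝ) - (1 - cdfR μ (x : ℝ))|

/-- `μ_k = E[ sup_{x ∈ [e^k, e^{k+1})} |p̂_x - p_x| ]`. -/
def meanSupDev (μ : Measure ℝ) (n k : ℕ) : ℝ := ∫ ω, supDev μ n k ω ∂(iidP μ n)

/-- `σ² = (1/4)·min( sup_{x ∈ [e^k, e^{k+1})} p_x, 1 )`. -/
def sigmaSq (μ : Measure ℝ) (k : ℕ) : ℝ :=
  (1 / 4) *
    min (⨆ x : Ico (Real.exp (k : ℝ)) (Real.exp ((k : ℝ) + 1)), (1 - cdfR μ (x : ℝ))) 1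

/-- The centred sum of the indicators of `A` along the sample, rescaled by the mass of `A`. As `A`
shrinks along a chain of sets, this is a martingale. -/
def scaledDev {α : Type*} [MeasurableSpace α] (μ : Measure α) {n : ℕ} (A : Set α)
    (ω : Fin n → α) : ℝ :=
  ∑ i, ((μ.real A)⁻¹ * A.indicator 1 (ω i) - 1)

section Chain

variable {α : Type*} [MeasurableSpace α] {μ : Measure α} {n : ℕ} {A B : Set α}

lemma measurable_scaledDev (hA : MeasurableSet A) :
    Measurable (scaledDev μ A : (Fin n → α) → ℝ) := by
  have h : Measurable (A.indicator (1 : α → ℝ)) := measurable_one.indicator hA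
  unfold scaledDev
  fun_prop

lemma abs_scaledDev_le (ω : Fin n → α) :
    |scaledDev μ A ω| ≤ n * ((μ.real A)⁻¹ + 1) := by
  refine (Finset.abs_sum_le_sum_abs _ _).trans ?_
  have h : ∀ i ∈ Finset.univ,
      |(μ.real A)⁻¹ * A.indicator 1 (ω i) - 1| ≤ (μ.real A)⁻¹ + 1 := by
    intro i _
    have h0 : 0 ≤ (μ.real A)⁻¹ := by positivity
    by_cases hi : ω i ∈ A
    · simp only [indicator_of_mem hi, Pi.one_apply, mul_one]
      rw [abs_le]
      constructor <;> linarith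
    · simp only [indicator_of_notMem hi, mul_zero, zero_sub, abs_neg, abs_one]
      linarith
  simpa [mul_add] using Finset.sum_le_sum h

variable [IsProbabilityMeasure μ]

lemma integral_update_mul_eval {h : (Fin n → α) → ℝ} (hh : Measurable h) {g : α → ℝ}
    (hg : Measurable g) (i : Fin n) (c : α) :
    ∫ ω, h (Function.update ω i c) * g (ω i) ∂(Measure.pi fun _ : Fin n => μ) =
      (∫ ω, h (Function.update ω i c) ∂(Measure.pi fun _ : Fin n => μ)) * ∫ x, g x ∂μ := by
  have hind := (ProbabilityTheory.iIndepFun_pi (μ := fun _ : Fin n => μ)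
    (X := fun _ x => x) (fun _ => aemeasurable_id)).indepFun_finset (Finset.univ.erase i) {i}
      (by simp) (fun j => measurable_pi_apply j)
  let φ : (((Finset.univ.erase i : Finset (Fin n))) → α) → ℝ := fun z =>
    h fun j => if hj : j = i then c else z ⟨j, by simp [hj]⟩
  let ψ : (({i} : Finset (Fin n)) → α) → ℝ := fun z => g (z ⟨i, by simp⟩)
  have hφ : Measurable φ := by
    refine hh.comp (measurable_pi_lambda _ fun j => ?_)
    by_cases hj : j = i
    · simp [hj]
    · simp only [hj, dite_false]
      exact measurable_pi_apply _
  have hψ : Measurable ψ := hg.comp (measurable_pi_apply _)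
  have hu : ∀ ω : Fin n → α, φ (fun j => ω j) = h (Function.update ω i c) := by
    intro ω
    simp only [φ]
    congr 1
    ext j
    by_cases hj : j = i
    · subst hj; simp
    · simp [hj]
  have key := (hind.comp hφ hψ).integral_fun_mul_eq_mul_integral
    (hφ.comp (by fun_prop)).aestronglyMeasurable (hψ.comp (by fun_prop)).aestronglyMeasurable
  simp only [Function.comp_def, hu] at key
  simp only [ψ] at key
  rw [key]
  congr 1
  exact integral_comp_eval (μ := fun _ : Fin n => μ) (i := i) hg.aestronglyMeasurable

lemma integral_mul_scaledIndicator {h : (Fin n → α) → ℝ} (hh : Measurable h)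
    (hB : MeasurableSet B) (hBA : B ⊆ A) (hB0 : μ.real B ≠ 0)
    {c : α} (hinv : ∀ ω i, ω i ∈ A → h (Function.update ω i c) = h ω) (i : Fin n) :
    ∫ ω, h ω * ((μ.real B)⁻¹ * B.indicator 1 (ω i)) ∂(Measure.pi fun _ : Fin n => μ) =
      ∫ ω, h (Function.update ω i c) ∂(Measure.pi fun _ : Fin n => μ) := by
  have h1 : ∀ ω : Fin n → α, h ω * ((μ.real B)⁻¹ * B.indicator 1 (ω i)) =
      h (Function.update ω i c) * ((μ.real B)⁻¹ * B.indicator 1 (ω i)) := by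
    intro ω
    by_cases hi : ω i ∈ B
    · rw [hinv ω i (hBA hi)]
    · simp [hi]
  simp_rw [h1]
  rw [integral_update_mul_eval hh (g := fun x => (μ.real B)⁻¹ * B.indicator 1 x)
    (measurable_const.mul (measurable_one.indicator hB)) i c, integral_const_mul,
    integral_indicator_one hB, inv_mul_cancel₀ hB0, mul_one]

/-- Orthogonality of the increments of `scaledDev`. -/
lemma integral_mul_scaledDev_sub {h : (Fin n → α) → ℝ} (hh : Measurable h) {R : ℝ}
    (hR : ∀ ω, |h ω| ≤ R)
    (hA : MeasurableSet A) (hB : MeasurableSet B) (hBA : B ⊆ A) (hB0 : μ.real B ≠ 0)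
    {c : α} (hinv : ∀ ω i, ω i ∈ A → h (Function.update ω i c) = h ω) :
    ∫ ω, h ω * (scaledDev μ B ω - scaledDev μ A ω) ∂(Measure.pi fun _ : Fin n => μ) = 0 := by
  have hA0 : μ.real A ≠ 0 := fun h0 => hB0 (measureReal_mono_null hBA h0)
  have hint : ∀ D : Set α, MeasurableSet D → ∀ i : Fin n,
      Integrable (fun ω => h ω * ((μ.real D)⁻¹ * D.indicator 1 (ω i)))
        (Measure.pi fun _ : Fin n => μ) := by
    intro D hD i
    have hm : Measurable (D.indicator (1 : α → ℝ)) := measurable_one.indicator hD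
    refine Integrable.of_bound (C := R * ((μ.real D)⁻¹ * 1))
      (by fun_prop : Measurable _).aestronglyMeasurable (ae_of_all _ fun ω => ?_)
    rw [Real.norm_eq_abs, abs_mul, abs_mul, abs_of_nonneg (by positivity : 0 ≤ (μ.real D)⁻¹)]
    have : |D.indicator (1 : α → ℝ) (ω i)| ≤ 1 := by
      by_cases hi : ω i ∈ D <;> simp [hi]
    have := hR ω
    have : 0 ≤ R := (abs_nonneg _).trans this
    gcongr
  have h1 : ∀ ω : Fin n → α, h ω * (scaledDev μ B ω - scaledDev μ A ω) =
      ∑ i, (h ω * ((μ.real B)⁻¹ * B.indicator 1 (ω i)) -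
        h ω * ((μ.real A)⁻¹ * A.indicator 1 (ω i))) := by
    intro ω
    rw [scaledDev, scaledDev, ← Finset.sum_sub_distrib, Finset.mul_sum]
    exact Finset.sum_congr rfl fun i _ => by ring
  simp_rw [h1]
  rw [integral_finsetSum _ fun i _ => by exact (hint B hB i).sub (hint A hA i)]
  refine Finset.sum_eq_zero fun i _ => ?_
  rw [integral_sub (hint B hB i) (hint A hA i),
    integral_mul_scaledIndicator hh hB hBA hB0 hinv i,
    integral_mul_scaledIndicator hh hA subset_rfl hA0 hinv i, sub_self]

lemma integrable_scaledDev_sq (hA : MeasurableSet A) :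
    Integrable (fun ω => scaledDev μ A ω ^ 2) (Measure.pi fun _ : Fin n => μ) := by
  refine Integrable.of_bound (C := (n * ((μ.real A)⁻¹ + 1)) ^ 2)
    ((measurable_scaledDev hA).pow_const 2).aestronglyMeasurable (ae_of_all _ fun ω => ?_)
  rw [Real.norm_eq_abs, abs_pow]
  gcongr
  exact abs_scaledDev_le ω

lemma integral_scaledDev_sq (hA : MeasurableSet A) (hA0 : μ.real A ≠ 0) :
    ∫ ω, scaledDev μ A ω ^ 2 ∂(Measure.pi fun _ : Fin n => μ) =
      n * ((μ.real A)⁻¹ - 1) := by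
  let f : α → ℝ := fun x => (μ.real A)⁻¹ * A.indicator 1 x - 1
  have hm : Measurable f := by
    have hm : Measurable (A.indicator (1 : α → ℝ)) := measurable_one.indicator hA
    fun_prop
  have hi : Integrable (A.indicator (1 : α → ℝ)) μ := (integrable_const 1).indicator hA
  have hf0 : ∫ x, f x ∂μ = 0 := by
    simp only [f]
    rw [integral_sub (hi.const_mul _) (integrable_const _), integral_const_mul,
      integral_indicator_one hA, inv_mul_cancel₀ hA0]
    simp
  have hf2 : ∫ x, f x ^ 2 ∂μ = (μ.real A)⁻¹ - 1 := by
    have : ∀ x, f x ^ 2 = ((μ.real A)⁻¹ ^ 2 - 2 * (μ.real A)⁻¹) * A.indicator 1 x + 1 := by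
      intro x
      by_cases hx : x ∈ A
      · simp only [f, indicator_of_mem hx, Pi.one_apply]; ring
      · simp [f, hx]
    simp_rw [this]
    rw [integral_add (hi.const_mul _) (integrable_const _), integral_const_mul,
      integral_indicator_one hA]
    simp only [integral_const, probReal_univ, smul_eq_mul, mul_one]
    field_simp
    ring
  have hL : MemLp f 2 μ := by
    refine MemLp.of_bound hm.aestronglyMeasurable ((μ.real A)⁻¹ + 1) (ae_of_all _ fun x => ?_)
    simpa [scaledDev] using abs_scaledDev_le (n := 1) (μ := μ) (A := A) (fun _ => x)
  have hvar := ProbabilityTheory.variance_sum_pi (ι := Fin n) (μ := fun _ => μ)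
    (X := fun _ => f) (fun _ => hL)
  have hs : (∑ i : Fin n, fun ω : Fin n → α => f (ω i)) = scaledDev μ A := by
    ext ω; simp [scaledDev, f]
  have hmean : ∫ ω, scaledDev μ A ω ∂(Measure.pi fun _ : Fin n => μ) = 0 := by
    simp only [scaledDev]
    rw [integral_finsetSum]
    · refine Finset.sum_eq_zero fun i _ => ?_
      exact (integral_comp_eval (μ := fun _ : Fin n => μ) (i := i)
        hm.aestronglyMeasurable).trans hf0
    · intro i _
      exact (measurePreserving_eval (fun _ : Fin n => μ) i).integrable_comp_of_integrable
        (hL.integrable (by norm_num))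
  rw [hs, ProbabilityTheory.variance_of_integral_eq_zero
    (measurable_scaledDev hA).aemeasurable hmean] at hvar
  rw [hvar]
  simp [ProbabilityTheory.variance_of_integral_eq_zero hm.aemeasurable hf0, hf2, mul_sub]

variable {ι : Type*} [LinearOrder ι] {S : ι → Set α}

/-- Kolmogorov's maximal inequality for `scaledDev` along a decreasing family of sets. -/
lemma sq_mul_measureReal_exists_le_scaledDev (hS : Antitone S) (hSm : ∀ t, MeasurableSet (S t))
    (T : Finset ι) {u : ι} (hu : ∀ t ∈ T, t ≤ u) (hu0 : μ.real (S u) ≠ 0) {ε : ℝ} (hε : 0 ≤ ε) :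
    ε ^ 2 * (Measure.pi fun _ : Fin n => μ).real {ω | ∃ t ∈ T, ε ≤ |scaledDev μ (S t) ω|} ≤
      n * ((μ.real (S u))⁻¹ - 1) := by
  classical
  set P := Measure.pi fun _ : Fin n => μ
  obtain ⟨c, hc⟩ : (S u).Nonempty := by
    rw [nonempty_iff_ne_empty]; intro h; simp [h] at hu0
  let E : ι → Set (Fin n → α) := fun t =>
    {ω | ε ≤ |scaledDev μ (S t) ω| ∧ ∀ s ∈ T, s < t → |scaledDev μ (S s) ω| < ε}
  have hM : ∀ t, Measurable (scaledDev μ (S t) : (Fin n → α) → ℝ) :=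
    fun t => measurable_scaledDev (hSm t)
  have hE : ∀ t, MeasurableSet (E t) := by
    intro t
    have hset : E t = {ω | ε ≤ |scaledDev μ (S t) ω|} ∩
        ⋂ s ∈ T, ⋂ _ : s < t, {ω | |scaledDev μ (S s) ω| < ε} := by
      ext ω; simp [E]
    rw [hset]
    refine (measurableSet_le measurable_const (hM t).abs).inter ?_
    exact T.measurableSet_biInter fun s _ => MeasurableSet.iInter fun _ =>
      measurableSet_lt (hM s).abs measurable_const
  have hunion : {ω : Fin n → α | ∃ t ∈ T, ε ≤ |scaledDev μ (S t) ω|} = ⋃ t ∈ T, E t := by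
    ext ω
    simp only [mem_ofPred_eq, mem_iUnion, exists_prop]
    constructor
    · rintro ⟨t, ht, hte⟩
      have hne : (T.filter fun t => ε ≤ |scaledDev μ (S t) ω|).Nonempty :=
        ⟨t, by simp [ht, hte]⟩
      have hmem := Finset.min'_mem _ hne
      rw [Finset.mem_filter] at hmem
      refine ⟨_, hmem.1, hmem.2, fun s hs hlt => ?_⟩
      by_contra! hge
      exact absurd (Finset.min'_le _ s (by simp [hs, hge])) (not_le.2 hlt)
    · rintro ⟨t, ht, hte⟩
      exact ⟨t, ht, hte.1⟩
  have hdisj : (T : Set ι).PairwiseDisjoint E := by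
    intro s hs t ht hst
    rw [Function.onFun, Set.disjoint_left]
    intro ω h1 h2
    rcases lt_or_gt_of_ne hst with h | h
    · exact absurd (h2.2 s hs h) (not_lt.2 h1.1)
    · exact absurd (h1.2 t ht h) (not_lt.2 h2.1)
  have hinv : ∀ s t, s ≤ t → ∀ ω : Fin n → α, ∀ i, t ≤ u → ω i ∈ S t →
      scaledDev μ (S s) (Function.update ω i c) = scaledDev μ (S s) ω := by
    intro s t hst ω i htu hi
    unfold scaledDev
    refine Finset.sum_congr rfl fun j _ => ?_
    by_cases hj : j = i
    · subst hj
      simp [hS hst hi, hS (hst.trans htu) hc]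
    · simp [hj]
  have hstep : ∀ t ∈ T, ε ^ 2 * P.real (E t) ≤ ∫ ω in E t, scaledDev μ (S u) ω ^ 2 ∂P := by
    intro t ht
    let h : (Fin n → α) → ℝ := (E t).indicator (scaledDev μ (S t))
    have horth := integral_mul_scaledDev_sub (μ := μ) (h := h) ((hM t).indicator (hE t))
      (R := n * ((μ.real (S t))⁻¹ + 1))
      (fun ω => by
        by_cases hω : ω ∈ E t
        · simpa [h, hω] using abs_scaledDev_le (μ := μ) (A := S t) ω
        · simp only [h, indicator_of_notMem hω, abs_zero]; positivity)
      (hSm t) (hSm u) (hS (hu t ht)) hu0 (c := c)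
      (fun ω i hi => by
        have hmem : Function.update ω i c ∈ E t ↔ ω ∈ E t := by
          simp only [E, mem_ofPred_eq, hinv t t le_rfl ω i (hu t ht) hi]
          refine and_congr_right fun _ => forall₂_congr fun s _ => ?_
          refine forall_congr' fun hst => ?_
          rw [hinv s t hst.le ω i (hu t ht) hi]
        by_cases hω : ω ∈ E t
        · simp only [h, indicator_of_mem hω, indicator_of_mem (hmem.2 hω)]
          exact hinv t t le_rfl ω i (hu t ht) hi
        · simp only [h, indicator_of_notMem hω, indicator_of_notMem (mt hmem.1 hω)])
    have hind : ∀ ω, h ω * (scaledDev μ (S u) ω - scaledDev μ (S t) ω) =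
        (E t).indicator (fun ω => scaledDev μ (S t) ω *
          (scaledDev μ (S u) ω - scaledDev μ (S t) ω)) ω := by
      intro ω
      by_cases hω : ω ∈ E t <;> simp [h, hω]
    simp_rw [hind] at horth
    rw [integral_indicator (hE t)] at horth
    have hcross : Integrable (fun ω => scaledDev μ (S t) ω *
        (scaledDev μ (S u) ω - scaledDev μ (S t) ω)) P := by
      refine Integrable.of_bound (C := (n * ((μ.real (S t))⁻¹ + 1)) *
        (n * ((μ.real (S u))⁻¹ + 1) + n * ((μ.real (S t))⁻¹ + 1)))
        ((hM t).mul ((hM u).sub (hM t))).aestronglyMeasurable (ae_of_all _ fun ω => ?_)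
      rw [Real.norm_eq_abs, abs_mul]
      have h1 := abs_scaledDev_le (μ := μ) (A := S t) ω
      have h2 := abs_scaledDev_le (μ := μ) (A := S u) ω
      have h3 := abs_sub (scaledDev μ (S u) ω) (scaledDev μ (S t) ω)
      gcongr
      linarith
    calc ε ^ 2 * P.real (E t)
        = ∫ ω in E t, (ε ^ 2 + 2 * (scaledDev μ (S t) ω *
            (scaledDev μ (S u) ω - scaledDev μ (S t) ω))) ∂P := by
          rw [integral_add (integrable_const _) (hcross.const_mul 2).integrableOn,
            integral_const_mul, horth]
          simp [mul_comm]
      _ ≤ ∫ ω in E t, scaledDev μ (S u) ω ^ 2 ∂P := by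
          refine setIntegral_mono_on ((integrable_const _).add
            (hcross.const_mul 2).integrableOn) (integrable_scaledDev_sq (hSm u)).integrableOn
            (hE t) fun ω hω => ?_
          have h1 : ε ^ 2 ≤ scaledDev μ (S t) ω ^ 2 := by
            rw [← sq_abs (scaledDev μ (S t) ω)]
            exact pow_le_pow_left₀ hε hω.1 2
          nlinarith [sq_nonneg (scaledDev μ (S u) ω - scaledDev μ (S t) ω)]
  rw [← integral_scaledDev_sq (hSm u) hu0, hunion, measureReal_biUnion_finset hdisj
    (fun t _ => hE t), Finset.mul_sum]
  calc ∑ t ∈ T, ε ^ 2 * P.real (E t)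
      ≤ ∑ t ∈ T, ∫ ω in E t, scaledDev μ (S u) ω ^ 2 ∂P := Finset.sum_le_sum hstep
    _ = ∫ ω in ⋃ t ∈ T, E t, scaledDev μ (S u) ω ^ 2 ∂P :=
        (integral_biUnion_finset T (fun t _ => hE t) hdisj
          fun t _ => (integrable_scaledDev_sq (hSm u)).integrableOn).symm
    _ ≤ ∫ ω, scaledDev μ (S u) ω ^ 2 ∂P :=
        setIntegral_le_integral (integrable_scaledDev_sq (hSm u))
          (ae_of_all _ fun ω => sq_nonneg _)

lemma measurable_finset_sup {Ω κ : Type*} [MeasurableSpace Ω] (T : Finset κ)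
    {f : κ → Ω → NNReal} (hf : ∀ t, Measurable (f t)) :
    Measurable fun ω => T.sup fun t => f t ω := by
  classical
  induction T using Finset.induction_on with
  | empty => simp
  | insert a T _ ih =>
    simp only [Finset.sup_insert]
    exact (hf a).sup ih

/-- If the tails of `X` decay like `s² / t²`, then the mean of `X` is at most `2 s`. -/
lemma lintegral_ofReal_le_of_sq_mul_tail_le {Ω : Type*} [MeasurableSpace Ω] {P : Measure Ω}
    [IsProbabilityMeasure P] {X : Ω → ℝ} (hX0 : ∀ ω, 0 ≤ X ω) (hX : Measurable X) {s : ℝ}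
    (hs : 0 < s) (h : ∀ t > 0, t ^ 2 * P.real {ω | t ≤ X ω} ≤ s ^ 2) :
    ∫⁻ ω, ENNReal.ofReal (X ω) ∂P ≤ ENNReal.ofReal (2 * s) := by
  rw [lintegral_eq_lintegral_meas_le P (ae_of_all _ hX0) hX.aemeasurable,
    ← Ioc_union_Ioi_eq_Ioi hs.le, lintegral_union measurableSet_Ioi
      (Set.disjoint_left.2 fun x hx hx' => absurd hx.2 (not_le.2 hx')), two_mul,
    ENNReal.ofReal_add hs.le hs.le]
  gcongr
  · calc ∫⁻ t in Ioc 0 s, P {ω | t ≤ X ω} ≤ ∫⁻ _ in Ioc 0 s, 1 :=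
          lintegral_mono fun _ => prob_le_one
      _ = ENNReal.ofReal s := by simp
  · calc ∫⁻ t in Ioi s, P {ω | t ≤ X ω}
        ≤ ∫⁻ t in Ioi s, ENNReal.ofReal (s ^ 2 * t ^ (-2 : ℝ)) := by
          refine setLIntegral_mono' measurableSet_Ioi fun t ht => ?_
          have ht0 : 0 < t := hs.trans ht
          rw [← ofReal_measureReal]
          refine ENNReal.ofReal_le_ofReal ?_
          rw [Real.rpow_neg ht0.le, Real.rpow_two, ← div_eq_mul_inv, le_div_iff₀ (by positivity),
            mul_comm]
          exact h t ht0
      _ = ENNReal.ofReal (∫ t in Ioi s, s ^ 2 * t ^ (-2 : ℝ)) := by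
          rw [ofReal_integral_eq_lintegral_ofReal]
          · exact (integrableOn_Ioi_rpow_of_lt (by norm_num) hs).const_mul _
          · filter_upwards [ae_restrict_mem measurableSet_Ioi] with t ht
            have ht0 : 0 < t := hs.trans ht
            positivity
      _ = ENNReal.ofReal s := by
          rw [integral_const_mul, integral_Ioi_rpow_of_lt (by norm_num) hs]
          norm_num
          rw [Real.rpow_neg_one]
          field_simp

lemma lintegral_sup_scaledDev_le (hS : Antitone S) (hSm : ∀ t, MeasurableSet (S t))
    (T : Finset ι) {u : ι} (hu : ∀ t ∈ T, t ≤ u) (hu0 : μ.real (S u) ≠ 0) {s : ℝ} (hs : 0 < s)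
    (hsn : n * ((μ.real (S u))⁻¹ - 1) ≤ s ^ 2) :
    ∫⁻ ω, (T.sup fun t => ‖scaledDev μ (S t) ω‖₊ : NNReal) ∂(Measure.pi fun _ : Fin n => μ) ≤
      ENNReal.ofReal (2 * s) := by
  have hmeas : Measurable fun ω : Fin n → α => T.sup fun t => ‖scaledDev μ (S t) ω‖₊ := by
    exact measurable_finset_sup T fun t => (measurable_scaledDev (hSm t)).nnnorm
  have key := lintegral_ofReal_le_of_sq_mul_tail_le (P := Measure.pi fun _ : Fin n => μ)
    (X := fun ω => ((T.sup fun t => ‖scaledDev μ (S t) ω‖₊ : NNReal) : ℝ))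
    (fun ω => NNReal.coe_nonneg _) hmeas.coe_nnreal_real hs
    (fun t ht => by
      refine le_trans (le_of_eq ?_)
        ((sq_mul_measureReal_exists_le_scaledDev hS hSm T hu hu0 ht.le).trans hsn)
      congr 3
      ext ω
      lift t to NNReal using ht.le
      have ht' : (⊥ : NNReal) < t := by simpa using ht
      rw [NNReal.coe_le_coe, Finset.le_sup_iff ht']
      simp only [← NNReal.coe_le_coe, coe_nnnorm, Real.norm_eq_abs])
  simpa using key

/-- Uniform deviation bound for empirical frequencies along a chain of sets of mass at least
`1 / 2` and at least `1 - q`. -/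
lemma lintegral_sup_empirical_sub_le (hn : 1 ≤ n) (hS : Antitone S)
    (hSm : ∀ t, MeasurableSet (S t)) (T : Finset ι) {q : ℝ} (hq : 0 < q)
    (hhalf : ∀ t ∈ T, 1 / 2 ≤ μ.real (S t)) (hTq : ∀ t ∈ T, 1 - q ≤ μ.real (S t)) :
    ∫⁻ ω, (T.sup fun t => ‖(n : ℝ)⁻¹ * ∑ i, (S t).indicator 1 (ω i) - μ.real (S t)‖₊ : NNReal)
        ∂(Measure.pi fun _ : Fin n => μ) ≤ ENNReal.ofReal (2 * √(2 * q / n)) := by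
  rcases T.eq_empty_or_nonempty with rfl | hT
  · simp
  have hn0 : (0 : ℝ) < n := by exact_mod_cast hn
  have hmem := T.max'_mem hT
  set u := T.max' hT
  have hu2 := hhalf u hmem
  have huq := hTq u hmem
  have hu0 : 0 < μ.real (S u) := by linarith
  have hsq : (n * √(2 * q / n)) ^ 2 = n * (2 * q) := by
    rw [mul_pow, Real.sq_sqrt (by positivity)]
    field_simp
  have hsn : n * ((μ.real (S u))⁻¹ - 1) ≤ (n * √(2 * q / n)) ^ 2 := by
    rw [hsq]
    gcongr
    rw [sub_le_iff_le_add, inv_le_iff_one_le_mul₀ hu0]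
    nlinarith
  have key := lintegral_sup_scaledDev_le (μ := μ) hS hSm T (fun t ht => T.le_max' t ht) hu0.ne'
    (by positivity : 0 < n * √(2 * q / n)) hsn
  have hle : ∀ ω : Fin n → α,
      ((T.sup fun t => ‖(n : ℝ)⁻¹ * ∑ i, (S t).indicator 1 (ω i) - μ.real (S t)‖₊ : NNReal) :
        ENNReal) ≤
      ENNReal.ofReal (n : ℝ)⁻¹ * (T.sup fun t => ‖scaledDev μ (S t) ω‖₊ : NNReal) := by
    intro ω
    rw [ENNReal.ofReal, ← ENNReal.coe_mul, ENNReal.coe_le_coe]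
    refine Finset.sup_le fun t ht => ?_
    refine le_trans ?_ (mul_le_mul_right
      (Finset.le_sup (f := fun t => ‖scaledDev μ (S t) ω‖₊) ht) _)
    rw [← NNReal.coe_le_coe]
    simp only [NNReal.coe_mul, coe_nnnorm, Real.norm_eq_abs,
      Real.coe_toNNReal _ (inv_nonneg.2 hn0.le)]
    have h0 : 0 < μ.real (S t) := by linarith [hhalf t ht]
    have heq : (n : ℝ)⁻¹ * ∑ i, (S t).indicator 1 (ω i) - μ.real (S t) =
        (n : ℝ)⁻¹ * (μ.real (S t) * scaledDev μ (S t) ω) := by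
      rw [scaledDev, Finset.sum_sub_distrib, ← Finset.mul_sum, mul_sub, ← mul_assoc (μ.real (S t)),
        mul_inv_cancel₀ h0.ne']
      simp only [Finset.sum_const, Finset.card_univ, Fintype.card_fin, nsmul_eq_mul, mul_one]
      field_simp
    rw [heq, abs_mul, abs_mul, abs_of_pos h0, abs_of_pos (inv_pos.2 hn0)]
    gcongr
    exact mul_le_of_le_one_left (abs_nonneg _) measureReal_le_one
  refine (lintegral_mono hle).trans ?_
  rw [lintegral_const_mul' _ _ ENNReal.ofReal_ne_top]
  refine (mul_le_mul_right key _).trans (le_of_eq ?_)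
  rw [← ENNReal.ofReal_mul (by positivity)]
  congr 1
  field_simp

end Chain

section Real

variable {μ : Measure ℝ} {n : ℕ}

lemma sum_indicator_Ioi (ω : Fin n → ℝ) (x : ℝ) :
    (n : ℝ)⁻¹ * ∑ i, (Ioi x).indicator (1 : ℝ → ℝ) (ω i) = empTail n ω x := by
  rw [empTail, div_eq_inv_mul, Finset.card_filter]
  congr 1
  push_cast
  exact Finset.sum_congr rfl fun i _ => by simp [indicator_apply]

lemma sum_indicator_Iic (hn : 1 ≤ n) (ω : Fin n → ℝ) (x : ℝ) :
    (n : ℝ)⁻¹ * ∑ i, (Iic x).indicator (1 : ℝ → ℝ) (ω i) = 1 - empTail n ω x := by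
  have hn0 : (n : ℝ) ≠ 0 := by positivity
  rw [← sum_indicator_Ioi, eq_sub_iff_add_eq, ← mul_add, ← Finset.sum_add_distrib]
  have h : ∀ i ∈ Finset.univ, (Iic x).indicator (1 : ℝ → ℝ) (ω i) +
      (Ioi x).indicator (1 : ℝ → ℝ) (ω i) = 1 := by
    intro i _
    rcases le_or_gt (ω i) x with h | h
    · simp [h]
    · simp [h]
  rw [Finset.sum_congr rfl h]
  simp [hn0]

lemma measurable_empTail (x : ℝ) : Measurable fun ω : Fin n → ℝ => empTail n ω x := by
  simp_rw [← sum_indicator_Ioi]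
  have h : Measurable ((Ioi x).indicator (1 : ℝ → ℝ)) := measurable_one.indicator measurableSet_Ioi
  fun_prop

lemma supDev_nonneg (k : ℕ) (ω : Fin n → ℝ) : 0 ≤ supDev μ n k ω :=
  Real.iSup_nonneg fun _ => abs_nonneg _

variable [IsProbabilityMeasure μ]

lemma measureReal_Ioi_eq_one_sub_cdfR (x : ℝ) : μ.real (Ioi x) = 1 - cdfR μ x := by
  rw [← compl_Iic, probReal_compl_eq_one_sub measurableSet_Iic]
  rfl

lemma lintegral_sup_dev_le_of_half_le_cdfR (hn : 1 ≤ n) (T : Finset ℝ) {q : ℝ} (hq : 0 < q)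
    (hhalf : ∀ x ∈ T, 1 / 2 ≤ cdfR μ x) (hTq : ∀ x ∈ T, 1 - cdfR μ x ≤ q) :
    ∫⁻ ω, (T.sup fun x => ‖empTail n ω x - (1 - cdfR μ x)‖₊ : NNReal) ∂(iidP μ n) ≤
      ENNReal.ofReal (2 * √(2 * q / n)) := by
  have key := lintegral_sup_empirical_sub_le (μ := μ) (S := fun x : ℝᵒᵈ => Iic (OrderDual.ofDual x))
    hn (fun x y hxy => Iic_subset_Iic.2 hxy) (fun _ => measurableSet_Iic)
    (T.map OrderDual.toDual.toEmbedding) hq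
    (by
      simp only [Finset.mem_map, forall_exists_index, and_imp]
      rintro _ x hx rfl
      exact hhalf x hx)
    (by
      simp only [Finset.mem_map, forall_exists_index, and_imp]
      rintro _ x hx rfl
      have := hTq x hx
      rw [cdfR] at this
      simp only [measureReal_def, Equiv.coe_toEmbedding, OrderDual.ofDual_toDual]
      linarith)
  simp only [Finset.sup_map, Function.comp_def, Equiv.coe_toEmbedding, OrderDual.ofDual_toDual,
    sum_indicator_Iic hn] at key
  refine le_trans (le_of_eq ?_) key
  refine lintegral_congr fun ω => ?_
  congr 2
  ext x
  rw [← nnnorm_neg, cdfR, measureReal_def]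
  congr 2
  ring

lemma lintegral_sup_dev_le_of_cdfR_le_half (hn : 1 ≤ n) (T : Finset ℝ)
    (hhalf : ∀ x ∈ T, cdfR μ x ≤ 1 / 2) :
    ∫⁻ ω, (T.sup fun x => ‖empTail n ω x - (1 - cdfR μ x)‖₊ : NNReal) ∂(iidP μ n) ≤
      ENNReal.ofReal (2 * √(2 / n)) := by
  have key := lintegral_sup_empirical_sub_le (μ := μ) (S := fun x : ℝ => Ioi x)
    hn (fun x y hxy => Ioi_subset_Ioi hxy) (fun _ => measurableSet_Ioi) T one_pos
    (fun x hx => by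
      rw [measureReal_Ioi_eq_one_sub_cdfR]
      linarith [hhalf x hx])
    (fun x _ => by simp)
  simp only [sum_indicator_Ioi, measureReal_Ioi_eq_one_sub_cdfR, mul_one] at key
  exact key

lemma ae_empTail_eq_of_cdfR_eq_zero (hn : 1 ≤ n) {x : ℝ} (hx : cdfR μ x = 0) :
    ∀ᵐ ω ∂(iidP μ n), empTail n ω x = 1 - cdfR μ x := by
  have hn0 : (n : ℝ) ≠ 0 := by positivity
  have h0 : μ (Iic x) = 0 := by
    rw [cdfR, ENNReal.toReal_eq_zero_iff] at hx
    exact hx.resolve_right (measure_ne_top _ _)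
  have h1 : ∀ᵐ y ∂μ, x < y := by
    filter_upwards [measure_eq_zero_iff_ae_notMem.1 h0] with y hy
    simpa using hy
  have h2 : ∀ᵐ ω ∂(iidP μ n), ∀ i, x < ω i :=
    ae_all_iff.2 fun i => (measurePreserving_eval (fun _ : Fin n => μ) i).quasiMeasurePreserving.ae h1
  filter_upwards [h2] with ω hω
  rw [empTail, Finset.filter_true_of_mem fun i _ => hω i, hx]
  simp [hn0]

/-- Uniform deviation bound over finitely many points where the tail probability is at most `q`
unless the distribution function vanishes. -/
lemma lintegral_sup_dev_le (hn : 1 ≤ n) (T : Finset ℝ) {q : ℝ} (hq : 0 < q)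
    (hTq : ∀ x ∈ T, 0 < cdfR μ x → 1 - cdfR μ x ≤ q) :
    ∫⁻ ω, (T.sup fun x => ‖empTail n ω x - (1 - cdfR μ x)‖₊ : NNReal) ∂(iidP μ n) ≤
      ENNReal.ofReal (8 * √(q / n)) := by
  classical
  have hn0 : (0 : ℝ) < n := by exact_mod_cast hn
  set d : ℝ → (Fin n → ℝ) → NNReal := fun x ω => ‖empTail n ω x - (1 - cdfR μ x)‖₊
  have hdm : ∀ x, Measurable (d x) := fun x => ((measurable_empTail x).sub_const _).nnnorm
  let T₁ := T.filter fun x => 1 / 2 ≤ cdfR μ x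
  let T₂ := T.filter fun x => 0 < cdfR μ x ∧ cdfR μ x < 1 / 2
  have hsqrt : √(4 * q / n) = 2 * √(q / n) := by
    rw [show 4 * q / n = 2 ^ 2 * (q / n) by ring, Real.sqrt_mul (by positivity),
      Real.sqrt_sq (by norm_num)]
  have h1 : ∫⁻ ω, (T₁.sup fun x => d x ω : NNReal) ∂(iidP μ n) ≤
      ENNReal.ofReal (4 * √(q / n)) := by
    refine (lintegral_sup_dev_le_of_half_le_cdfR hn T₁ hq
      (fun x hx => (Finset.mem_filter.1 hx).2) fun x hx => ?_).trans ?_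
    · obtain ⟨hx, hx'⟩ := Finset.mem_filter.1 hx
      exact hTq x hx (by linarith)
    · refine ENNReal.ofReal_le_ofReal ?_
      have : √(2 * q / n) ≤ √(4 * q / n) := Real.sqrt_le_sqrt (by gcongr; norm_num)
      linarith
  have h2 : ∫⁻ ω, (T₂.sup fun x => d x ω : NNReal) ∂(iidP μ n) ≤
      ENNReal.ofReal (4 * √(q / n)) := by
    rcases T₂.eq_empty_or_nonempty with h | ⟨x, hx⟩
    · simp [h]
    refine (lintegral_sup_dev_le_of_cdfR_le_half hn T₂
      fun x hx => (Finset.mem_filter.1 hx).2.2.le).trans ?_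
    obtain ⟨hx, hx0, hx'⟩ := Finset.mem_filter.1 hx
    have hq2 := hTq x hx hx0
    refine ENNReal.ofReal_le_ofReal ?_
    have : √(2 / n) ≤ √(4 * q / n) := Real.sqrt_le_sqrt (by gcongr; linarith)
    linarith
  have h0 : ∀ᵐ ω ∂(iidP μ n), ∀ x ∈ T, cdfR μ x = 0 → d x ω = 0 := by
    rw [Filter.eventually_all_finset]
    intro x _
    by_cases hx : cdfR μ x = 0
    · filter_upwards [ae_empTail_eq_of_cdfR_eq_zero hn hx] with ω hω _
      simp [d, hω]
    · exact ae_of_all _ fun ω h => absurd h hx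
  calc ∫⁻ ω, (T.sup fun x => d x ω : NNReal) ∂(iidP μ n)
      ≤ ∫⁻ ω, ((T₁.sup fun x => d x ω : NNReal) : ENNReal) + (T₂.sup fun x => d x ω : NNReal)
          ∂(iidP μ n) := by
        refine lintegral_mono_ae ?_
        filter_upwards [h0] with ω hω
        rw [← ENNReal.coe_add, ENNReal.coe_le_coe]
        refine Finset.sup_le fun x hx => ?_
        have hcdf : 0 ≤ cdfR μ x := ENNReal.toReal_nonneg
        rcases hcdf.eq_or_lt with h | h
        · rw [hω x hx h.symm]
          exact zero_le
        rcases le_or_gt (1 / 2) (cdfR μ x) with h' | h'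
        · exact (Finset.le_sup (f := fun x => d x ω) (Finset.mem_filter.2 ⟨hx, h'⟩)).trans
            le_self_add
        · exact (Finset.le_sup (f := fun x => d x ω) (Finset.mem_filter.2 ⟨hx, h, h'⟩)).trans
            le_add_self
    _ ≤ ENNReal.ofReal (4 * √(q / n)) + ENNReal.ofReal (4 * √(q / n)) := by
        rw [lintegral_add_left (measurable_finset_sup T₁ hdm).coe_nnreal_ennreal]
        exact add_le_add h1 h2
    _ = ENNReal.ofReal (8 * √(q / n)) := by
        rw [← ENNReal.ofReal_add (by positivity) (by positivity)]
        congr 1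
        ring

lemma continuousWithinAt_empTail_Ioi (ω : Fin n → ℝ) (x : ℝ) :
    ContinuousWithinAt (empTail n ω) (Ioi x) x := by
  have h : ∀ᶠ y in nhdsWithin x (Ioi x), ∀ i, (y < ω i ↔ x < ω i) := by
    rw [Filter.eventually_all]
    intro i
    rcases lt_or_ge x (ω i) with hi | hi
    · filter_upwards [mem_nhdsWithin_of_mem_nhds (Iio_mem_nhds hi)] with y hy
      exact ⟨fun _ => hi, fun _ => hy⟩
    · filter_upwards [self_mem_nhdsWithin] with y hy
      exact ⟨fun h => absurd (hi.trans_lt hy) h.le.not_gt, fun h => absurd h hi.not_gt⟩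
  refine tendsto_const_nhds.congr' ?_
  filter_upwards [h] with y hy
  simp only [empTail, hy]

lemma continuousWithinAt_cdfR_Ioi (x : ℝ) : ContinuousWithinAt (cdfR μ) (Ioi x) x := by
  have h : cdfR μ = ProbabilityTheory.cdf μ := by
    ext y
    rw [ProbabilityTheory.cdf_eq_real]
    rfl
  rw [h]
  exact ((ProbabilityTheory.cdf μ).right_continuous x).mono Ioi_subset_Ici_self

/-- By right-continuity the supremum may be taken over a dense sequence. -/
lemma exists_seq_ofReal_supDev_le (k : ℕ) : ∃ a : ℕ → ℝ,
    (∀ j, Real.exp k ≤ a j) ∧ ∀ ω : Fin n → ℝ, ENNReal.ofReal (supDev μ n k ω) ≤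
      ⨆ N, ((((Finset.range N).image a).sup fun x =>
        ‖empTail n ω x - (1 - cdfR μ x)‖₊ : NNReal) : ENNReal) := by
  classical
  have hlt : Real.exp k < Real.exp (k + 1) := Real.exp_lt_exp.2 (by linarith)
  let Q : Set ℝ := range ((↑) : ℚ → ℝ) ∩ Ioo (Real.exp k) (Real.exp (k + 1))
  obtain ⟨r, hr1, hr2⟩ := exists_rat_btwn hlt
  obtain ⟨a, ha⟩ := ((countable_range ((↑) : ℚ → ℝ)).mono inter_subset_left :
    Q.Countable).exists_eq_range ⟨r, ⟨r, rfl⟩, hr1, hr2⟩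
  refine ⟨a, fun j => ?_, fun ω => ?_⟩
  · have : a j ∈ Q := ha ▸ mem_range_self j
    exact this.2.1.le
  set M : ENNReal := ⨆ N, ((((Finset.range N).image a).sup fun x =>
        ‖empTail n ω x - (1 - cdfR μ x)‖₊ : NNReal) : ENNReal)
  rcases eq_or_ne M ⊤ with htop | htop
  · simp [htop]
  have hseq : ∀ j, |empTail n ω (a j) - (1 - cdfR μ (a j))| ≤ M.toReal := by
    intro j
    have h1 : (‖empTail n ω (a j) - (1 - cdfR μ (a j))‖₊ : ENNReal) ≤ M := by
      refine le_trans ?_ (le_iSup _ (j + 1))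
      rw [ENNReal.coe_le_coe]
      exact Finset.le_sup (f := fun x => ‖empTail n ω x - (1 - cdfR μ x)‖₊)
        (Finset.mem_image_of_mem a (by simp))
    simpa using ENNReal.toReal_mono htop h1
  rw [← ENNReal.ofReal_toReal htop]
  refine ENNReal.ofReal_le_ofReal (Real.iSup_le (fun x => ?_) ENNReal.toReal_nonneg)
  obtain ⟨x, hx1, hx2⟩ := x
  have hcont : ContinuousWithinAt (fun y => |empTail n ω y - (1 - cdfR μ y)|) (Ioi x) x :=
    ((continuousWithinAt_empTail_Ioi ω x).sub
      (continuousWithinAt_const.sub (continuousWithinAt_cdfR_Ioi x))).abs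
  refine le_of_tendsto_of_frequently hcont ?_
  rw [frequently_nhdsWithin_iff, Filter.frequently_iff]
  intro U hU
  obtain ⟨b, hb, hbU⟩ := exists_Ico_subset_of_mem_nhds hU ⟨_, hx2⟩
  obtain ⟨r, hr1, hr2⟩ := exists_rat_btwn (lt_min hb hx2)
  have hrQ : (r : ℝ) ∈ Q :=
    ⟨⟨r, rfl⟩, hx1.trans_lt hr1, hr2.trans_le (min_le_right _ _)⟩
  rw [ha] at hrQ
  obtain ⟨j, hj⟩ := hrQ
  exact ⟨r, hbU ⟨hr1.le, hr2.trans_le (min_le_left _ _)⟩, hj ▸ hseq j, hr1⟩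

lemma meanSupDev_le (hn : 1 ≤ n) {k : ℕ} {q : ℝ} (hq : 0 < q)
    (hkq : ∀ x, Real.exp k ≤ x → 0 < cdfR μ x → 1 - cdfR μ x ≤ q) :
    meanSupDev μ n k ≤ 8 * √(q / n) := by
  classical
  rw [meanSupDev]
  by_cases hint : Integrable (supDev μ n k) (iidP μ n)
  swap
  · rw [integral_undef hint]
    positivity
  obtain ⟨a, hak, ha⟩ := exists_seq_ofReal_supDev_le (μ := μ) (n := n) k
  rw [← ENNReal.ofReal_le_ofReal_iff (by positivity),
    ofReal_integral_eq_lintegral_ofReal hint (ae_of_all _ (supDev_nonneg k))]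
  refine (lintegral_mono ha).trans ?_
  rw [lintegral_iSup]
  · refine iSup_le fun N => lintegral_sup_dev_le hn _ hq fun x hx => ?_
    obtain ⟨j, -, rfl⟩ := Finset.mem_image.1 hx
    exact hkq _ (hak j)
  · exact fun N => (measurable_finset_sup _
      fun x => ((measurable_empTail x).sub_const _).nnnorm).coe_nnreal_ennreal
  · intro N N' hN ω
    rw [ENNReal.coe_le_coe]
    exact Finset.sup_mono (Finset.image_subset_image (Finset.range_mono hN))

end Real

lemma tail_le_of_mem_SOP {τ β C C' K : ℝ} (hτ : 0 < τ) (hβ : 0 < β) (hC' : 0 < C')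
    (hCK : C ≤ K) (hCK' : C' ≤ K) {μ : Measure ℝ} (hμ : μ ∈ SOP τ β C C') {k : ℕ} {x : ℝ}
    (hx : Real.exp k ≤ x) (hF : 0 < cdfR μ x) :
    1 - cdfR μ x ≤ 2 * K * Real.exp (-(k : ℝ) * τ) := by
  obtain ⟨hprob, -, h⟩ := hμ
  have hx1 : 1 ≤ x := (Real.one_le_exp (Nat.cast_nonneg k)).trans hx
  have hF1 : cdfR μ x ≤ 1 := measureReal_le_one (μ := μ)
  have h1 := (abs_le.1 (h x ⟨hF, hF1⟩)).2
  have h2 : x ^ (-(τ * (β + 1))) ≤ x ^ (-τ) :=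
    Real.rpow_le_rpow_of_exponent_le hx1 (by nlinarith [mul_pos hτ hβ])
  have h3 : x ^ (-τ) ≤ Real.exp (-(k : ℝ) * τ) := by
    refine (Real.rpow_le_rpow_of_nonpos (Real.exp_pos _) hx (by linarith)).trans (le_of_eq ?_)
    rw [← Real.exp_mul]
    congr 1
    ring
  have h4 : 0 ≤ x ^ (-τ) := Real.rpow_nonneg (by linarith) _
  have hK : 0 < K := hC'.trans_le hCK'
  calc 1 - cdfR μ x ≤ C * x ^ (-τ) + C' * x ^ (-(τ * (β + 1))) := by linarith
    _ ≤ K * x ^ (-τ) + K * x ^ (-τ) := by gcongr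
    _ = 2 * K * x ^ (-τ) := by ring
    _ ≤ 2 * K * Real.exp (-(k : ℝ) * τ) := by gcongr

/-- Lemma (expectsup): there is a constant `D₁`, depending only on `β₁`, a lower bound `τ₀` on
`τ` and an upper bound `K` on `C, C'`, such that for `1 ≤ k ≤ ⌊log(n^{1/(τ(2β₁+1))})⌋`,
`E[sup_{x ∈ [e^k, e^{k+1})} |p̂_x - p_x|] ≤ D₁·√(e^{-kτ}/n)`. -/
theorem expected_sup_deviation
    (β₁ τ₀ K : ℝ) (hβ₁ : 0 < β₁) (hτ₀ : 0 < τ₀) (hK : 0 < K) :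
    ∃ D₁ > (0 : ℝ), ∀ τ C C' : ℝ, τ₀ ≤ τ → 0 < C → 0 < C' → C ≤ K → C' ≤ K →
      ∀ μ ∈ SOP τ β₁ C C', ∀ n : ℕ, 1 ≤ n → ∀ k : ℕ, 1 ≤ k →
        (k : ℝ) ≤ Real.log ((n : ℝ) ^ (1 / (τ * (2 * β₁ + 1)))) →
        meanSupDev μ n k ≤ D₁ * Real.sqrt (Real.exp (-(k : ℝ) * τ) / n) := by
  refine ⟨8 * √(2 * K), by positivity, fun τ C C' hτ _ hC' hCK hCK' μ hμ n hn k _ _ => ?_⟩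
  have : IsProbabilityMeasure μ := hμ.1
  refine (meanSupDev_le hn (q := 2 * K * Real.exp (-(k : ℝ) * τ)) (by positivity)
    fun x => tail_le_of_mem_SOP (hτ₀.trans_le hτ) hβ₁ hC' hCK hCK' hμ).trans (le_of_eq ?_)
  rw [mul_div_assoc, Real.sqrt_mul (by positivity), mul_assoc]

end
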